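/- arXiv:math/9810128 — 2 statements merged into one kernel-verified Lean document; each statement's English description precedes it below -/
import Mathlib

section
/- If a continuum Y has a local cut point that is not a cut point — that is, a point k such that Y \ {k} is connected, but there is an open set U containing k such that U \ {k} is the union of two nonempty separated sets A and B, with k a limit point of both A and B — then Y is a 2-to-1 retract of a continuum. -/
open Set Metric Topology

/-- A subcontinuum of a topological space: a nonempty compact connected subset. -/
def IsSubcontinuum {X : Type*} [TopologicalSpace X] (K : Set X) : Prop :=
  IsCompact K ∧ IsConnected K

/-- The metric space `Y` is an `m`-to-1 retract of a continuum: there is a continuum `X`,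
a subcontinuum `Y'` of `X` homeomorphic to `Y`, and a continuous retraction of `X` onto `Y'`
under which every point of `Y'` has exactly `m` preimages. -/
def IsMToOneRetract (m : ℕ) (Y : Type*) [MetricSpace Y] : Prop :=
  ∃ (X : Type) (_ : MetricSpace X), CompactSpace X ∧ ConnectedSpace X ∧ Nonempty X ∧
    ∃ Y' : Set X, IsSubcontinuum Y' ∧ Nonempty (Y ≃ₜ Y') ∧
      ∃ r : X → X, Continuous r ∧ (∀ x, r x ∈ Y') ∧ (∀ y ∈ Y', r y = y) ∧
        ∀ y ∈ Y', {x : X | r x = y}.ncard = m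

/-- A 1-to-1 cover of a map `f` : a restriction of `f` to an open proper subset `U`
of the domain such that `f` is injective on `U` and `f(U) = f(X)`. -/
def HasOneToOneCover {X Y : Type*} [TopologicalSpace X] (f : X → Y) : Prop :=
  ∃ U : Set X, IsOpen U ∧ U ≠ Set.univ ∧ Set.InjOn f U ∧ f '' U = Set.range f

/-- Strictly locally 1-to-1: locally injective but not injective. -/
def StrictlyLocallyInjective {X Y : Type*} [TopologicalSpace X] (f : X → Y) : Prop :=
  (∀ x : X, ∃ U ∈ 𝓝 x, Set.InjOn f U) ∧ ¬ Function.Injective f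

/-- A map is simple if each point-inverse of a point of the image has cardinality one or two. -/
def SimpleMap {X Y : Type*} (f : X → Y) : Prop :=
  ∀ y ∈ Set.range f, (f ⁻¹' {y}).ncard = 1 ∨ (f ⁻¹' {y}).ncard = 2

/-- `f` is injective on each proper subcontinuum of its domain. -/
def InjOnProperSubcontinua {X Y : Type*} [TopologicalSpace X] (f : X → Y) : Prop :=
  ∀ K : Set X, IsSubcontinuum K → K ≠ Set.univ → Set.InjOn f K

/-- Two sets are separated if neither contains a limit point of the other. -/
def SeparatedSets {X : Type*} [TopologicalSpace X] (A B : Set X) : Prop :=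
  Disjoint (closure A) B ∧ Disjoint A (closure B)

/-- Every subcontinuum with more than one point is the union of two proper subcontinua. -/
def HereditarilyDecomposable (X : Type*) [TopologicalSpace X] : Prop :=
  ∀ K : Set X, IsSubcontinuum K → K.Nontrivial →
    ∃ A B : Set X, IsSubcontinuum A ∧ IsSubcontinuum B ∧
      A ⊆ K ∧ B ⊆ K ∧ A ≠ K ∧ B ≠ K ∧ A ∪ B = K

/-- Arclike: for each `ε > 0` there is an `ε`-map onto `[0,1]`. -/
def Arclike (X : Type*) [MetricSpace X] : Prop :=
  ∀ ε > (0:ℝ), ∃ g : X → ℝ, Continuous g ∧ Set.range g = Set.Icc 0 1 ∧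
    ∀ t : ℝ, Metric.diam (g ⁻¹' {t}) < ε

/-- A tree: a connected finite graph (a continuum that is a finite union of arcs meeting
only at endpoints) containing no simple closed curve. -/
def IsTree (T : Type*) [MetricSpace T] : Prop :=
  CompactSpace T ∧ ConnectedSpace T ∧ Nonempty T ∧
    (∃ (n : ℕ) (γ : Fin n → ℝ → T),
      (∀ i, ContinuousOn (γ i) (Set.Icc 0 1) ∧ Set.InjOn (γ i) (Set.Icc 0 1)) ∧
      (⋃ i, γ i '' Set.Icc 0 1) = Set.univ ∧
      (∀ i j, i ≠ j →
        (γ i '' Set.Icc 0 1) ∩ (γ j '' Set.Icc 0 1) ⊆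
          ({γ i 0, γ i 1, γ j 0, γ j 1} : Set T))) ∧
    ¬ ∃ S : Set T, Nonempty (S ≃ₜ (Metric.sphere (0:ℂ) 1))

/-- Treelike: for each `ε > 0` there is an `ε`-map onto a tree. -/
def Treelike (X : Type*) [MetricSpace X] : Prop :=
  ∀ ε > (0:ℝ), ∃ (T : Type) (_ : MetricSpace T), IsTree T ∧
    ∃ g : X → T, Continuous g ∧ Function.Surjective g ∧
      ∀ t : T, Metric.diam (g ⁻¹' {t}) < ε
/-- If the union of the zero section and the graph of a nowhere vanishing function `g` is a
continuum in `Y × ℝ`, then projecting it vertically shows that `Y` is a 2-to-1 retract. -/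
theorem isMToOneRetract_two_of_graph (Y : Type) [MetricSpace Y] [CompactSpace Y]
    [ConnectedSpace Y] (S : Set (Y × ℝ)) (hc : IsCompact S) (hconn : IsConnected S)
    (g : Y → ℝ) (hg : ∀ y, g y ≠ 0) (hS : ∀ p, p ∈ S ↔ p.2 = 0 ∨ p.2 = g p.1) :
    IsMToOneRetract 2 Y := by
  have h0 : ∀ y, (y, (0 : ℝ)) ∈ S := fun y => (hS _).2 (Or.inl rfl)
  have h1 : ∀ y, (y, g y) ∈ S := fun y => (hS _).2 (Or.inr rfl)
  let i : Y → S := fun y => ⟨(y, 0), h0 y⟩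
  have hi : Continuous i := by fun_prop
  have hinj : Function.Injective i := fun y z h => congrArg (fun x : S => x.1.1) h
  have hemb : IsEmbedding i := (hi.isClosedEmbedding hinj).isEmbedding
  refine ⟨S, inferInstance, isCompact_iff_compactSpace.1 hc,
    isConnected_iff_connectedSpace.1 hconn, hconn.nonempty.to_subtype, range i,
    ⟨isCompact_range hi, isConnected_range hi⟩, ⟨hemb.toHomeomorph⟩,
    fun x => i x.1.1, by fun_prop, fun x => mem_range_self _, ?_, ?_⟩
  · rintro _ ⟨y, rfl⟩
    rfl
  · rintro _ ⟨y, rfl⟩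
    have hfib : {x : S | i x.1.1 = i y} = {i y, ⟨(y, g y), h1 y⟩} := by
      ext ⟨⟨z, t⟩, hz⟩
      have := (hS _).1 hz
      simp only [mem_ofPred_eq, hinj.eq_iff, mem_insert_iff, mem_singleton_iff, i,
        Subtype.mk.injEq, Prod.mk.injEq]
      constructor
      · rintro rfl
        simpa using this
      · rintro (h | h) <;> exact h.1
    rw [hfib, ncard_pair]
    intro h
    exact hg y (congrArg (fun x : S => x.1.2) h).symm

/-- If the continuum `Y` has a local cut point `k` that is not a cut point, i.e. `Y \ {k}`
is connected but there is an open set `U ∋ k` with `U \ {k} = A ∪ B`, two nonempty separated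
sets, and `k` is a limit point of both `A` and `B`, then `Y` is a 2-to-1 retract. -/
theorem local_cut_point_implies_two_to_one_retract
    (Y : Type) [MetricSpace Y] [CompactSpace Y] [ConnectedSpace Y] [Nonempty Y]
    (k : Y) (hconn : IsConnected ({k}ᶜ : Set Y))
    (U : Set Y) (hU : IsOpen U) (hkU : k ∈ U)
    (A B : Set Y) (hAB : U \ {k} = A ∪ B) (hA : A.Nonempty) (hB : B.Nonempty)
    (hsep : SeparatedSets A B)
    (hlimA : k ∈ closure A) (hlimB : k ∈ closure B) :
    IsMToOneRetract 2 Y := by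
  obtain ⟨ε, hε, hball⟩ := Metric.nhds_basis_closedBall.mem_iff.1 (hU.mem_nhds hkU)
  have hkA : k ∈ closure (closedBall k ε ∩ A) :=
    closure_mono (inter_subset_inter_left _ ball_subset_closedBall)
      (isOpen_ball.inter_closure ⟨mem_ball_self hε, hlimA⟩)
  have hkB : k ∈ closure (closedBall k ε ∩ B) :=
    closure_mono (inter_subset_inter_left _ ball_subset_closedBall)
      (isOpen_ball.inter_closure ⟨mem_ball_self hε, hlimB⟩)
  set A' := closedBall k ε ∩ A
  set B' := closedBall k ε ∩ B
  have hneA : A'.Nonempty := closure_nonempty_iff.1 ⟨k, hkA⟩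
  have hneB : B'.Nonempty := closure_nonempty_iff.1 ⟨k, hkB⟩
  let a : Y → ℝ := fun y => infDist y A'
  let b : Y → ℝ := fun y => infDist y B'
  have ha : Continuous a := continuous_infDist_pt A'
  have hb : Continuous b := continuous_infDist_pt B'
  have ha0 : ∀ y, 0 ≤ a y := fun y => infDist_nonneg
  have hb0 : ∀ y, 0 ≤ b y := fun y => infDist_nonneg
  have hka : a k = 0 := (mem_closure_iff_infDist_zero hneA).1 hkA
  have hkb : b k = 0 := (mem_closure_iff_infDist_zero hneB).1 hkB
  have hAB' : ∀ y, y ≠ k → y ∈ closedBall k ε → y ∈ A ∨ y ∈ B := fun y hy hyε => by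
    have : y ∈ U \ {k} := ⟨hball hyε, hy⟩
    rwa [hAB] at this
  have hpos : ∀ y, y ≠ k → 0 < a y + b y := by
    intro y hy
    by_contra! hle
    have hya : y ∈ closure A' :=
      (mem_closure_iff_infDist_zero hneA).2 (by linarith [ha0 y, hb0 y] : a y = 0)
    have hyb : y ∈ closure B' :=
      (mem_closure_iff_infDist_zero hneB).2 (by linarith [ha0 y, hb0 y] : b y = 0)
    have hyε : y ∈ closedBall k ε := closure_minimal inter_subset_left isClosed_closedBall hya
    rcases hAB' y hy hyε with h | h
    · exact disjoint_left.1 hsep.2 h (closure_mono inter_subset_right hyb)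
    · exact disjoint_left.1 hsep.1 (closure_mono inter_subset_right hya) h
  have hkne : ∀ y ∈ A ∪ B, y ≠ k := fun y hy => by
    rw [← hAB] at hy
    exact hy.2
  let f : Y → ℝ := fun y => a y / (a y + b y) + dist y k
  have hfA : ∀ y ∈ A', f y = dist y k := fun y hy => by
    have : a y = 0 := infDist_zero_of_mem hy
    simp [f, this]
  have hfB : ∀ y ∈ B', f y = 1 + dist y k := fun y hy => by
    have h := hpos y (hkne y (Or.inr hy.2))
    have hy0 : b y = 0 := infDist_zero_of_mem hy
    rw [hy0, add_zero] at h
    simp [f, hy0, h.ne']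
  have hfpos : ∀ y, y ≠ k → 0 < f y := fun y hy =>
    add_pos_of_nonneg_of_pos (div_nonneg (ha0 y) (hpos y hy).le) (dist_pos.2 hy)
  have hfle : ∀ y, f y ≤ 1 + diam (univ : Set Y) := fun y =>
    add_le_add (div_le_one_of_le₀ (by linarith [hb0 y]) (by linarith [ha0 y, hb0 y]))
      (dist_le_diam_of_mem isCompact_univ.isBounded trivial trivial)
  have hfc : ContinuousOn f {k}ᶜ :=
    (ha.continuousOn.div (ha.add hb).continuousOn fun y hy => (hpos y hy).ne').add
      (by fun_prop)
  classical
  let g : Y → ℝ := Function.update f k 1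
  have hgk : g k = 1 := Function.update_self ..
  have hgf : ∀ y, y ≠ k → g y = f y := fun y hy => Function.update_of_ne hy ..
  have hgpos : ∀ y, 0 < g y := fun y => by
    by_cases hy : y = k
    · rw [hy, hgk]
      exact one_pos
    · rw [hgf y hy]
      exact hfpos y hy
  have hgle : ∀ y, g y ≤ 1 + diam (univ : Set Y) := fun y => by
    by_cases hy : y = k
    · rw [hy, hgk]
      linarith [diam_nonneg (s := (univ : Set Y))]
    · rw [hgf y hy]
      exact hfle y
  let S : Set (Y × ℝ) := {p | p.2 = 0 ∨ p.2 = g p.1}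
  have hSeq : S = {p | p.2 = 0 ∨ ((p.2 - dist p.1 k) * (a p.1 + b p.1) = a p.1 ∧
      ((p.2 - dist p.1 k) * (p.2 - dist p.1 k - 1) = 0 ∨ ε ≤ dist p.1 k))} := by
    ext ⟨y, t⟩
    simp only [S, mem_ofPred_eq]
    by_cases hy : y = k
    · subst hy
      simp only [hgk, hka, hkb, dist_self, sub_zero, add_zero, mul_zero, true_and,
        not_le.2 hε, or_false, mul_eq_zero, sub_eq_zero]
      tauto
    · have hp := hpos y hy
      have key : t = g y ↔ (t - dist y k) * (a y + b y) = a y := by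
        rw [hgf y hy, ← eq_div_iff hp.ne', sub_eq_iff_eq_add]
      rw [key]
      refine or_congr_right ⟨fun h => ⟨h, ?_⟩, fun h => h.1⟩
      by_cases hyε : ε ≤ dist y k
      · exact Or.inr hyε
      · left
        have hyb : y ∈ closedBall k ε := (not_le.1 hyε).le
        have ht := key.2 h
        rw [hgf y hy] at ht
        rcases hAB' y hy hyb with hyA | hyB
        · rw [ht, hfA y ⟨hyb, hyA⟩]
          ring
        · rw [ht, hfB y ⟨hyb, hyB⟩]
          ring
  have hSclosed : IsClosed S := by
    rw [hSeq]
    refine IsClosed.union ?_ (IsClosed.inter ?_ (IsClosed.union ?_ ?_))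
    · exact isClosed_eq (by fun_prop) (by fun_prop)
    · exact isClosed_eq (by fun_prop) (by fun_prop)
    · exact isClosed_eq (by fun_prop) (by fun_prop)
    · exact isClosed_le continuous_const (continuous_fst.dist continuous_const)
  have hScompact : IsCompact S := by
    refine (isCompact_univ.prod (isCompact_Icc (a := (0 : ℝ))
      (b := 1 + diam (univ : Set Y)))).of_isClosed_subset hSclosed ?_
    rintro ⟨y, t⟩ (h | h)
    · have : (0 : ℝ) ≤ 1 + diam (univ : Set Y) := (hgpos y).le.trans (hgle y)
      simp_all
    · exact ⟨trivial, h.symm ▸ (hgpos y).le, h.symm ▸ hgle y⟩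
  let G : Set (Y × ℝ) := (fun y => (y, f y)) '' {k}ᶜ
  have hG : IsConnected G := hconn.image _ (continuousOn_id.prodMk hfc)
  have hG0 : (k, (0 : ℝ)) ∈ closure G := by
    have h := map_mem_closure (f := fun y => (y, dist y k)) (t := G) (by fun_prop) hkA
      fun y hy => ⟨y, hkne y (Or.inl hy.2), by simp only [hfA y hy]⟩
    simpa using h
  have hG1 : (k, (1 : ℝ)) ∈ closure G := by
    have h := map_mem_closure (f := fun y => (y, 1 + dist y k)) (t := G) (by fun_prop) hkB
      fun y hy => ⟨y, hkne y (Or.inr hy.2), by simp only [hfB y hy]⟩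
    simpa using h
  have hG' : IsConnected (insert (k, (0 : ℝ)) (insert (k, (1 : ℝ)) G)) :=
    hG.subset_closure ((subset_insert _ _).trans (subset_insert _ _))
      (insert_subset hG0 (insert_subset hG1 subset_closure))
  have hY : IsConnected (range fun y : Y => (y, (0 : ℝ))) := isConnected_range (by fun_prop)
  have hSconn : IsConnected S := by
    have h := hY.union (t := insert (k, (0 : ℝ)) (insert (k, (1 : ℝ)) G))
      ⟨(k, 0), mem_range_self k, mem_insert _ _⟩ hG'
    convert h using 1
    ext ⟨y, t⟩
    by_cases hy : y = k
    · subst hy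
      simp [S, G, hgk, eq_comm, or_comm]
    · simp [S, G, Ne.symm hy, hgf y hy, eq_comm]
  exact isMToOneRetract_two_of_graph Y S hScompact hSconn g (fun y => (hgpos y).ne')
    fun _ => Iff.rfl
end

section
/- If f is a strictly locally 1-to-1 continuous map from a continuum X into a continuum Y, f is injective on each proper subcontinuum of X, and there is at least one point p of X with f⁻¹(f(p)) = {p}, then f(X) (and hence Y, which contains it) is a 2-to-1 retract of a continuum. -/
open Set Metric Topology

/-- For a locally injective map, the pairs of distinct points with the same image form a
closed set. -/
theorem isClosed_setOf_ne_and_eq {X Y : Type*} [TopologicalSpace X] [TopologicalSpace Y]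
    [T2Space Y] {f : X → Y} (hf : Continuous f) (hloc : ∀ x : X, ∃ U ∈ 𝓝 x, InjOn f U) :
    IsClosed {q : X × X | q.1 ≠ q.2 ∧ f q.1 = f q.2} := by
  rw [← isOpen_compl_iff, isOpen_iff_mem_nhds]
  rintro ⟨a, b⟩ hab
  by_cases h : f a = f b
  · obtain rfl : a = b := by
      by_contra hne
      exact hab ⟨hne, h⟩
    obtain ⟨U, hU, hinj⟩ := hloc a
    filter_upwards [prod_mem_nhds hU hU] with q hq hq'
    exact hq'.1 (hinj hq.1 hq.2 hq'.2)
  · have hopen : IsOpen {q : X × X | f q.1 ≠ f q.2} :=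
      isOpen_ne_fun (hf.comp continuous_fst) (hf.comp continuous_snd)
    filter_upwards [hopen.mem_nhds h] with q hq hq'
    exact hq hq'.2

/-- If the pairs of distinct points of a compact Hausdorff space with the same image form a closed
set, and the map is injective on the component of `x`, then it is injective on a clopen
neighborhood of `x`. -/
theorem exists_isClopen_injOn_of_injOn_connectedComponent {D Y : Type*} [TopologicalSpace D]
    [CompactSpace D] [T2Space D] {g : D → Y}
    (hE : IsClosed {q : D × D | q.1 ≠ q.2 ∧ g q.1 = g q.2}) (x : D)
    (hinj : InjOn g (connectedComponent x)) :
    ∃ V : Set D, IsClopen V ∧ x ∈ V ∧ InjOn g V := by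
  have : Nonempty {s : Set D // IsClopen s ∧ x ∈ s} := ⟨⟨univ, isClopen_univ, mem_univ x⟩⟩
  obtain ⟨V, hV⟩ := hE.isCompact.elim_directed_family_closed
    (fun s : {s : Set D // IsClopen s ∧ x ∈ s} ↦ s.1 ×ˢ s.1)
    (fun s ↦ s.2.1.isClosed.prod s.2.1.isClosed)
    (by
      rw [eq_empty_iff_forall_notMem]
      rintro q ⟨hq, hmem⟩
      rw [mem_iInter] at hmem
      refine hq.1 (hinj ?_ ?_ hq.2) <;>
        rw [connectedComponent_eq_iInter_isClopen, mem_iInter]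
      · exact fun s ↦ (hmem s).1
      · exact fun s ↦ (hmem s).2)
    (fun s t ↦ ⟨⟨s.1 ∩ t.1, s.2.1.inter t.2.1, s.2.2, t.2.2⟩,
      prod_mono inter_subset_left inter_subset_left,
      prod_mono inter_subset_right inter_subset_right⟩)
  refine ⟨V.1, V.2.1, V.2.2, fun a ha b hb hab ↦ ?_⟩
  by_contra hne
  exact eq_empty_iff_forall_notMem.mp hV (a, b) ⟨⟨hne, hab⟩, ha, hb⟩

/-- A continuous map on a compact space that is injective on a clopen neighborhood of each point
maps some open set bijectively onto its range. -/
theorem exists_isOpen_injOn_image_eq_range {D Y : Type*} [TopologicalSpace D] [CompactSpace D]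
    [TopologicalSpace Y] [T2Space Y] {g : D → Y} (hg : Continuous g)
    (hloc : ∀ x, ∃ V : Set D, IsClopen V ∧ x ∈ V ∧ InjOn g V) :
    ∃ T : Set D, IsOpen T ∧ InjOn g T ∧ g '' T = range g := by
  have key : ∃ S T : Set D, (univ : Set D) ⊆ S ∧ IsClosed S ∧ IsOpen T ∧ T ⊆ S ∧ InjOn g T ∧
      g '' T = g '' S := by
    refine isCompact_univ.induction_on (p := fun s ↦ ∃ S T : Set D, s ⊆ S ∧ IsClosed S ∧
      IsOpen T ∧ T ⊆ S ∧ InjOn g T ∧ g '' T = g '' S) ?_ ?_ ?_ ?_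
    · exact ⟨∅, ∅, by simp⟩
    · rintro s t hst ⟨S, T, hS, h⟩
      exact ⟨S, T, hst.trans hS, h⟩
    · rintro s t ⟨S, T, hs, hS, hT, hTS, hinj, himg⟩ ⟨S', T', hs', hS', hT', hTS', hinj', himg'⟩
      have hcl : IsClosed (g ⁻¹' (g '' S)) := (hS.isCompact.image hg).isClosed.preimage hg
      refine ⟨S ∪ S', T ∪ (T' \ g ⁻¹' (g '' S)), union_subset_union hs hs', hS.union hS',
        hT.union (hT'.sdiff hcl), union_subset_union hTS (sdiff_subset.trans hTS'), ?_, ?_⟩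
      · rintro a (ha | ha) b (hb | hb) hab
        · exact hinj ha hb hab
        · exact absurd ⟨a, hTS ha, hab⟩ hb.2
        · exact absurd ⟨b, hTS hb, hab.symm⟩ ha.2
        · exact hinj' ha.1 hb.1 hab
      · apply subset_antisymm (image_mono (union_subset_union hTS (sdiff_subset.trans hTS')))
        rintro _ ⟨a, ha, rfl⟩
        by_cases haS : g a ∈ g '' S
        · rw [← himg] at haS
          exact image_mono subset_union_left haS
        · rcases ha with ha | ha
          · exact absurd (mem_image_of_mem g ha) haS
          · obtain ⟨b, hb, hba⟩ : g a ∈ g '' T' := himg' ▸ mem_image_of_mem g ha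
            refine ⟨b, Or.inr ⟨hb, fun h ↦ haS ?_⟩, hba⟩
            rwa [← hba]
    · intro x _
      obtain ⟨V, hV, hx, hinj⟩ := hloc x
      exact ⟨V, mem_nhdsWithin_of_mem_nhds (hV.isOpen.mem_nhds hx), V, V, Subset.rfl,
        hV.isClosed, hV.isOpen, Subset.rfl, hinj, rfl⟩
  obtain ⟨S, T, hS, -, hT, -, hinj, himg⟩ := key
  exact ⟨T, hT, hinj, by rw [himg, univ_subset_iff.mp hS, image_univ]⟩

/-- A strictly locally injective map on a compact space that is injective on proper subcontinua and
has a one-point fiber has a 1-to-1 cover. -/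
theorem hasOneToOneCover_of_strictlyLocallyInjective {X Y : Type*} [TopologicalSpace X]
    [CompactSpace X] [T2Space X] [TopologicalSpace Y] [T2Space Y] {f : X → Y}
    (hf : Continuous f) (hsl : StrictlyLocallyInjective f) (hinj : InjOnProperSubcontinua f)
    {p : X} (hp : f ⁻¹' {f p} = {p}) : HasOneToOneCover f := by
  have hE := isClosed_setOf_ne_and_eq hf hsl.1
  set D : Set X := Prod.fst '' {q : X × X | q.1 ≠ q.2 ∧ f q.1 = f q.2}
  have hDc : IsCompact D := hE.isCompact.image continuous_fst
  have mem_D {a b : X} (hne : a ≠ b) (hab : f a = f b) : a ∈ D := ⟨(a, b), ⟨hne, hab⟩, rfl⟩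
  have hpD : p ∉ D := by
    rintro ⟨⟨a, b⟩, ⟨hne, hab⟩, rfl⟩
    have hb : b ∈ f ⁻¹' {f a} := hab.symm
    rw [hp] at hb
    exact hne hb.symm
  have : CompactSpace D := isCompact_iff_compactSpace.mp hDc
  have hg : Continuous (fun x : D ↦ f x) := hf.comp continuous_subtype_val
  have hED : IsClosed {q : D × D | q.1 ≠ q.2 ∧ f q.1 = f q.2} := by
    have := hE.preimage (f := Prod.map ((↑) : D → X) ((↑) : D → X)) (by fun_prop)
    simpa [preimage, Subtype.coe_inj] using this
  obtain ⟨T, hT, hTinj, hTimg⟩ := exists_isOpen_injOn_image_eq_range hg fun x ↦ by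
    refine exists_isClopen_injOn_of_injOn_connectedComponent hED x ?_
    have hK : InjOn f ((↑) '' connectedComponent x : Set X) := by
      refine hinj _ ⟨isClosed_connectedComponent.isCompact.image continuous_subtype_val,
        isConnected_connectedComponent.image _ continuous_subtype_val.continuousOn⟩ fun h ↦ ?_
      obtain ⟨y, -, rfl⟩ := h.symm ▸ mem_univ p
      exact hpD y.2
    exact fun a ha b hb hab ↦
      Subtype.ext (hK (mem_image_of_mem _ ha) (mem_image_of_mem _ hb) hab)
  have hC : IsClosed ((↑) '' Tᶜ : Set X) :=
    (hT.isClosed_compl.isCompact.image continuous_subtype_val).isClosed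
  have mem_T {a : X} (haD : a ∈ D) (ha : a ∈ ((↑) '' Tᶜ : Set X)ᶜ) : (⟨a, haD⟩ : D) ∈ T := by
    by_contra h
    exact ha ⟨⟨a, haD⟩, h, rfl⟩
  have hU : InjOn f ((↑) '' Tᶜ : Set X)ᶜ := by
    intro a ha b hb hab
    by_contra hne
    have := hTinj (mem_T (mem_D hne hab) ha) (mem_T (mem_D (Ne.symm hne) hab.symm) hb) hab
    exact hne (congrArg Subtype.val this)
  refine ⟨((↑) '' Tᶜ : Set X)ᶜ, hC.isOpen_compl, fun h ↦ ?_, hU,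
    subset_antisymm (image_subset_range _ _) ?_⟩
  · rw [h] at hU
    exact hsl.2 (injOn_univ.mp hU)
  · rintro _ ⟨a, rfl⟩
    by_cases ha : a ∈ ((↑) '' Tᶜ : Set X)
    · obtain ⟨d, -, rfl⟩ := ha
      obtain ⟨e, he, hed⟩ := hTimg.symm ▸ mem_range_self (f := fun x : D ↦ f x) d
      refine ⟨e, ?_, hed⟩
      rintro ⟨e', he', hee⟩
      exact he' (Subtype.ext hee ▸ he)
    · exact ⟨a, ha, rfl⟩

/-- The codomain of a map between continua that has a 1-to-1 cover is a 2-to-1 retract. The retract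
sits at height `0` in a subset of `Y × ℝ`; above the range of `f` lies a copy of the cover, and
below its complement a second copy of the complement. -/
theorem HasOneToOneCover.isMToOneRetract_two {X Y : Type} [MetricSpace X] [CompactSpace X]
    [ConnectedSpace X] [MetricSpace Y] [CompactSpace Y] [ConnectedSpace Y]
    {f : X → Y} (hf : Continuous f) (h : HasOneToOneCover f) : IsMToOneRetract 2 Y := by
  obtain ⟨U, hU, hne, hinj, himg⟩ := h
  obtain ⟨x₀, hx₀⟩ := (ne_univ_iff_exists_notMem U).mp hne
  have hUc : IsClosed Uᶜ := hU.isClosed_compl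
  have hZ : IsClosed (range f) := (isCompact_range hf).isClosed
  have hZne : (range f).Nonempty := ⟨f x₀, x₀, rfl⟩
  let base : Y → Y × ℝ := fun y ↦ (y, 0)
  let lower : Y → Y × ℝ := fun y ↦ (y, -infDist y (range f))
  let upper : X → Y × ℝ := fun x ↦ (f x, infDist x Uᶜ)
  have hbase : Continuous base := by fun_prop
  have hlower : Continuous lower := continuous_id.prodMk (continuous_infDist_pt _).neg
  have hupper : Continuous upper := hf.prodMk (continuous_infDist_pt _)
  have infDist_eq_zero {x : X} (hx : x ∉ U) : infDist x Uᶜ = 0 := infDist_zero_of_mem hx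
  have infDist_pos {x : X} (hx : x ∈ U) : 0 < infDist x Uᶜ :=
    (hUc.notMem_iff_infDist_pos ⟨x₀, hx₀⟩).mp (not_not.mpr hx)
  set W : Set (Y × ℝ) := range base ∪ range lower ∪ range upper
  have hWcompact : IsCompact W :=
    ((isCompact_range hbase).union (isCompact_range hlower)).union (isCompact_range hupper)
  have hWconn : IsConnected W := by
    refine IsConnected.union ⟨(f x₀, 0), Or.inl ⟨f x₀, rfl⟩, x₀, ?_⟩
      (IsConnected.union ⟨(f x₀, 0), ⟨f x₀, rfl⟩, f x₀, ?_⟩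
        (isConnected_range hbase) (isConnected_range hlower)) (isConnected_range hupper)
    · simp [upper, infDist_eq_zero hx₀]
    · simp [lower, infDist_zero_of_mem (mem_range_self x₀)]
  have base_mem (y : Y) : (y, (0 : ℝ)) ∈ W := Or.inl (Or.inl ⟨y, rfl⟩)
  let emb : Y → W := fun y ↦ ⟨(y, 0), base_mem y⟩
  have hemb : Continuous emb := hbase.subtype_mk _
  have hproj : Continuous fun w : W ↦ w.1.1 := continuous_fst.comp continuous_subtype_val
  refine ⟨W, inferInstance, isCompact_iff_compactSpace.mp hWcompact,
    isConnected_iff_connectedSpace.mp hWconn, hWconn.nonempty.to_subtype, range emb,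
    ⟨isCompact_range hemb, isConnected_range hemb⟩, ⟨?_⟩, fun w ↦ emb w.1.1, hemb.comp hproj,
    fun w ↦ ⟨_, rfl⟩, ?_, ?_⟩
  · exact
      { toFun := fun y ↦ ⟨emb y, y, rfl⟩
        invFun := fun w ↦ w.1.1.1
        left_inv := fun y ↦ rfl
        right_inv := by
          rintro ⟨_, y, rfl⟩
          rfl
        continuous_toFun := hemb.subtype_mk _
        continuous_invFun := hproj.comp continuous_subtype_val }
  · rintro _ ⟨y, rfl⟩
    rfl
  · rintro _ ⟨y, rfl⟩
    have hfiber (w : W) : emb w.1.1 = emb y ↔ w.1.1 = y :=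
      ⟨fun h ↦ congrArg (fun v : W ↦ v.1.1) h, fun h ↦ congrArg emb h⟩
    simp_rw [hfiber]
    rw [ncard_eq_two]
    by_cases hy : y ∈ range f
    · obtain ⟨u, hu, rfl⟩ := himg.symm ▸ hy
      refine ⟨emb (f u), ⟨upper u, Or.inr ⟨u, rfl⟩⟩, fun h ↦ ?_, ?_⟩
      · exact (infDist_pos hu).ne (congrArg (fun v : W ↦ v.1.2) h)
      · ext w
        refine ⟨?_, ?_⟩
        · obtain ⟨w, (⟨z, rfl⟩ | ⟨z, rfl⟩) | ⟨x, rfl⟩⟩ := w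
          · rintro rfl
            exact Or.inl rfl
          · rintro rfl
            left
            apply Subtype.ext
            simp [lower, emb, infDist_zero_of_mem hy]
          · intro (hx : f x = f u)
            by_cases hxU : x ∈ U
            · obtain rfl := hinj hxU hu hx
              exact Or.inr rfl
            · left
              apply Subtype.ext
              simp [upper, emb, infDist_eq_zero hxU, hx]
        · rintro (rfl | rfl) <;> rfl
    · have hpos := (hZ.notMem_iff_infDist_pos hZne).mp hy
      refine ⟨emb y, ⟨lower y, Or.inl (Or.inr ⟨y, rfl⟩)⟩, fun h ↦ ?_, ?_⟩
      · exact (neg_neg_of_pos hpos).ne' (congrArg (fun v : W ↦ v.1.2) h)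
      · ext w
        refine ⟨?_, ?_⟩
        · obtain ⟨w, (⟨z, rfl⟩ | ⟨z, rfl⟩) | ⟨x, rfl⟩⟩ := w
          · rintro rfl
            exact Or.inl rfl
          · rintro rfl
            exact Or.inr rfl
          · intro hx
            exact absurd ⟨x, hx⟩ hy
        · rintro (rfl | rfl) <;> rfl

/-- A 1-to-1 cover of a map is also a 1-to-1 cover of its corestriction to its range. -/
theorem HasOneToOneCover.rangeFactorization {X Y : Type*} [TopologicalSpace X] {f : X → Y}
    (h : HasOneToOneCover f) : HasOneToOneCover (Set.rangeFactorization f) := by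
  obtain ⟨U, hU, hne, hinj, himg⟩ := h
  refine ⟨U, hU, hne, fun a ha b hb hab ↦ hinj ha hb (congrArg Subtype.val hab), ?_⟩
  refine subset_antisymm (image_subset_range _ _) ?_
  rintro _ ⟨a, rfl⟩
  obtain ⟨b, hb, hba⟩ := himg.symm ▸ mem_range_self a
  exact ⟨b, hb, Subtype.ext hba⟩

/-- If `f` is a strictly locally 1-to-1 map from a continuum `X` into a continuum `Y`,
`f` is injective on each proper subcontinuum of `X`, and there is a 1-to-1 point for `f`,
then `f(X)`, and hence `Y`, is a 2-to-1 retract of a continuum. -/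
theorem image_and_codomain_are_two_to_one_retracts_of_strictlyLocallyInjective
    (X Y : Type) [MetricSpace X] [CompactSpace X] [ConnectedSpace X] [Nonempty X]
    [MetricSpace Y] [CompactSpace Y] [ConnectedSpace Y] [Nonempty Y]
    (f : X → Y) (hf : Continuous f)
    (hsl : StrictlyLocallyInjective f) (hinj : InjOnProperSubcontinua f)
    (p : X) (hp : f ⁻¹' {f p} = {p}) :
    IsMToOneRetract 2 ↥(Set.range f) ∧ IsMToOneRetract 2 Y := by
  have hcover := hasOneToOneCover_of_strictlyLocallyInjective hf hsl hinj hp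
  have : CompactSpace (range f) := isCompact_iff_compactSpace.mp (isCompact_range hf)
  have : ConnectedSpace (range f) := isConnected_iff_connectedSpace.mp (isConnected_range hf)
  exact ⟨hcover.rangeFactorization.isMToOneRetract_two (hf.subtype_mk _),
    hcover.isMToOneRetract_two hf⟩
end
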